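/- MacMahon–Schur combinatorial Rogers–Ramanujan: for every natural number n, the number of partitions of n in which any two consecutive parts differ by at least 2 equals the number of partitions of n into parts congruent to ±1 modulo 5. -/

import Mathlib

open Finset

namespace RR

variable {R : Type*} [CommRing R]

/-- q-Pochhammer `(q;q)_n`. -/
def poch (q : R) (n : ℕ) : R := ∏ i ∈ range n, (1 - q ^ (i + 1))

/-- Gaussian binomials. -/
def gb (q : R) : ℕ → ℕ → R
  | _, 0 => 1
  | 0, _ + 1 => 0
  | n + 1, k + 1 => gb q n (k + 1) + q ^ (n - k) * gb q n k

@[simp] lemma gb_zero_right (q : R) (n : ℕ) : gb q n 0 = 1 := by cases n <;> simp [gb]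

lemma gb_succ (q : R) (n k : ℕ) :
    gb q (n + 1) (k + 1) = gb q n (k + 1) + q ^ (n - k) * gb q n k := by simp [gb]

lemma gb_of_lt (q : R) {n k : ℕ} (h : n < k) : gb q n k = 0 := by
  induction n generalizing k with
  | zero => obtain ⟨k, rfl⟩ := Nat.exists_eq_add_of_lt h; simp [gb]
  | succ n ih =>
    obtain ⟨k, rfl⟩ : ∃ m, k = m + 1 := ⟨k - 1, by omega⟩
    rw [gb_succ, ih (by omega), ih (by omega)]; simp

@[simp] lemma gb_self (q : R) (n : ℕ) : gb q n n = 1 := by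
  induction n with
  | zero => simp
  | succ n ih => rw [gb_succ, gb_of_lt q (by omega), ih]; simp

/-- The other Pascal rule. -/
lemma gb_succ' (q : R) (n k : ℕ) :
    gb q (n + 1) (k + 1) = gb q n k + q ^ (k + 1) * gb q n (k + 1) := by
  induction n generalizing k with
  | zero =>
    cases k with
    | zero => simp [gb]
    | succ k => simp [gb]
  | succ n ih =>
    cases k with
    | zero =>
      have s1 := gb_succ q (n + 1) 0
      have s2 := gb_succ q n 0
      have i1 := ih 0
      simp only [gb_zero_right, Nat.sub_zero] at s1 s2 i1 ⊢
      linear_combination s1 + i1 - q ^ (0 + 1) * s2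
    | succ k =>
      rcases lt_trichotomy n (k + 1) with h | h | h
      · rcases Nat.lt_or_ge n k with h1 | h1
        · rw [gb_of_lt q (by omega : n + 1 + 1 < k + 1 + 1),
            gb_of_lt q (by omega : n + 1 < k + 1 + 1), gb_of_lt q (by omega : n + 1 < k + 1)]
          simp
        · obtain rfl : n = k := by omega
          rw [gb_of_lt q (by omega : n + 1 < n + 1 + 1)]; simp
      · subst h
        have s1 := gb_succ q (k + 1 + 1) (k + 1)
        have s3 := gb_succ q (k + 1) k
        have i1 := ih k
        rw [show k + 1 + 1 - (k + 1) = 1 by omega] at s1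
        rw [show k + 1 - k = 1 by omega] at s3
        simp only [gb_self] at *
        linear_combination s1 + q ^ 1 * i1 - s3
      · obtain ⟨d, rfl⟩ : ∃ d, n = k + 1 + d + 1 := ⟨n - k - 2, by omega⟩
        have s1 := gb_succ q (k + 1 + d + 1 + 1) (k + 1)
        have s2 := gb_succ q (k + 1 + d + 1) (k + 1)
        have s3 := gb_succ q (k + 1 + d + 1) k
        have i1 := ih k
        have i2 := ih (k + 1)
        rw [show k + 1 + d + 1 + 1 - (k + 1) = d + 2 by omega] at s1
        rw [show k + 1 + d + 1 - (k + 1) = d + 1 by omega] at s2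
        rw [show k + 1 + d + 1 - k = d + 2 by omega] at s3
        linear_combination s1 + i2 + q ^ (d + 2) * i1 - s3 - q ^ (k + 2) * s2

/-- `gb` in terms of Pochhammers. -/
lemma gb_mul_poch (q : R) (a b : ℕ) :
    gb q (a + b) a * (poch q a * poch q b) = poch q (a + b) := by
  suffices H : ∀ n a b, a + b = n → gb q (a + b) a * (poch q a * poch q b) = poch q (a + b) from
    H _ a b rfl
  intro n
  induction n with
  | zero => intro a b h; obtain rfl : a = 0 := by omega
            obtain rfl : b = 0 := by omega
            simp [poch]
  | succ n ih =>
    intro a b h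
    cases a with
    | zero => simp [poch]
    | succ a =>
      cases b with
      | zero => simp [poch]
      | succ b =>
        have h1 := ih a (b + 1) (by omega)
        have h2 := ih (a + 1) b (by omega)
        rw [show a + 1 + (b + 1) = a + b + 1 + 1 by omega, gb_succ,
          show a + b + 1 - a = b + 1 by omega]
        rw [show a + (b + 1) = a + b + 1 by omega] at h1
        rw [show a + 1 + b = a + b + 1 by omega] at h2
        simp only [poch, prod_range_succ] at h1 h2 ⊢
        linear_combination (1 - q ^ (b+1)) * h2 + q ^ (b + 1) * (1 - q ^ (a + 1)) * h1

/-- A family of inverses of Pochhammers. -/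
def IsInv (q : R) (r : ℕ → R) : Prop := ∀ n, poch q n * r n = 1

lemma IsInv.succ {q : R} {r : ℕ → R} (h : IsInv q r) (n : ℕ) :
    r n = (1 - q ^ (n + 1)) * r (n + 1) := by
  have h1 := h n
  have h2 := h (n + 1)
  simp only [poch, prod_range_succ] at h1 h2
  linear_combination (-r n) * h2 + (1 - q ^ (n + 1)) * r (n + 1) * h1

lemma IsInv.zero {q : R} {r : ℕ → R} (h : IsInv q r) : r 0 = 1 := by
  simpa [poch] using h 0

lemma IsInv.gb_mul {q : R} {r : ℕ → R} (h : IsInv q r) {n k : ℕ} (hk : k ≤ n) :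
    gb q n k * r n = r k * r (n - k) := by
  obtain ⟨b, rfl⟩ := Nat.exists_eq_add_of_le hk
  rw [Nat.add_sub_cancel_left]
  have h0 := gb_mul_poch q k b
  have h1 := h k
  have h2 := h b
  have h3 := h (k + b)
  linear_combination (-gb q (k+b) k * r (k+b)) * (h1) -
    gb q (k+b) k * r (k+b) * poch q k * r k * h2 + r k * r b * r (k+b) * h0 + r k * r b * h3

/-- Limiting q-Vandermonde. -/
lemma vandermonde_gb {q : R} {r : ℕ → R} (h : IsInv q r) (A m : ℕ) :
    ∑ t ∈ range (A + 1), q ^ (t * (t + m)) * gb q A t * r (t + m) = r (A + m) := by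
  induction A generalizing m with
  | zero => simp
  | succ A ih =>
    rw [sum_range_succ']
    have e : ∀ t ∈ range (A + 1), q ^ ((t + 1) * (t + 1 + m)) * gb q (A + 1) (t + 1) * r (t + 1 + m)
        = q ^ ((t + 1) * (t + 1 + m)) * gb q A (t + 1) * r (t + 1 + m)
          + q ^ (A + m + 1) * (q ^ (t * (t + (m + 1))) * gb q A t * r (t + (m + 1))) := by
      intro t ht
      obtain ⟨d, rfl⟩ : ∃ d, A = t + d := ⟨A - t, by simp at ht; omega⟩
      rw [gb_succ, show t + d - t = d by omega, show t + 1 + m = t + (m + 1) by omega]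
      ring
    rw [sum_congr rfl e, sum_add_distrib, ← mul_sum, ih (m + 1)]
    have h2 := ih m
    rw [sum_range_succ'] at h2
    rw [sum_range_succ _ A, gb_of_lt q (by omega : A < A + 1)]
    have h3 := h.succ (A + m)
    simp only [gb_zero_right, zero_mul, mul_zero, add_zero, zero_add, pow_zero, one_mul, mul_one]
      at h2 ⊢
    rw [show A + 1 + m = A + m + 1 by omega, show A + (m + 1) = A + m + 1 by omega]
    linear_combination h2 + h3

lemma vandermonde {q : R} {r : ℕ → R} (h : IsInv q r) (A m : ℕ) :
    ∑ t ∈ range (A + 1), q ^ (t * (t + m)) * r (A - t) * r t * r (t + m) = r A * r (A + m) := by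
  rw [← vandermonde_gb h A m, mul_sum]
  refine sum_congr rfl fun t ht => ?_
  have := h.gb_mul (n := A) (k := t) (by simp at ht; omega)
  linear_combination (-(q ^ (t * (t + m)) * r (t + m))) * this

/-- Signed theta coefficients. -/
def cf (q u v : R) : ℤ → R
  | Int.ofNat j => (-1) ^ j * u ^ j * q ^ (j.choose 2)
  | Int.negSucc j => (-1) ^ (j + 1) * v ^ (j + 1) * q ^ ((j + 1).choose 2)

lemma cf_nat (q u v : R) (j : ℕ) : cf q u v j = (-1) ^ j * u ^ j * q ^ (j.choose 2) := rfl

lemma cf_neg (q u v : R) (j : ℕ) : cf q u v (-j) = (-1) ^ j * v ^ j * q ^ (j.choose 2) := by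
  cases j with
  | zero => simpa using cf_nat q u v 0
  | succ j => rfl

lemma cf_succ (q u v : R) (j : ℕ) : cf q u v (j + 1 : ℕ) = - u * q ^ j * cf q u v j := by
  rw [cf_nat, cf_nat, Nat.choose_succ_succ' j 1, Nat.choose_one_right]; ring

lemma cf_neg_succ (q u v : R) (j : ℕ) :
    cf q u v (-(j + 1 : ℕ)) = - v * q ^ j * cf q u v (-j) := by
  rw [cf_neg, cf_neg, Nat.choose_succ_succ' j 1, Nat.choose_one_right]; ring

lemma jtp_zero (q u v : R) (b : ℕ) :
    ∏ i ∈ range b, (1 - v * q ^ i) =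
      ∑ k ∈ range (b + 1), cf q u v ((k : ℤ) - b) * gb q b k := by
  induction b with
  | zero => have := cf_nat q u v 0; simp at this; simp [this]
  | succ b ih =>
    rw [prod_range_succ, ih, sum_range_succ' _ (b + 1)]
    have e : ∀ k ∈ range (b + 1), cf q u v (((k + 1 : ℕ) : ℤ) - (b + 1 : ℕ)) * gb q (b + 1) (k + 1)
       = cf q u v ((k : ℤ) - b) * gb q b k
         - v * q ^ b * (cf q u v (((k + 1 : ℕ) : ℤ) - b) * gb q b (k + 1)) := by
      intro k hk
      rw [gb_succ', show (((k + 1 : ℕ) : ℤ) - (b + 1 : ℕ)) = (k : ℤ) - b by push_cast; ring]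
      rcases Nat.lt_or_ge k b with h | h
      · obtain ⟨d, rfl⟩ : ∃ d, b = k + 1 + d := ⟨b - k - 1, by omega⟩
        have := cf_neg_succ q u v d
        rw [show ((k : ℤ) - (k + 1 + d : ℕ)) = (-(d + 1 : ℕ)) by push_cast; ring,
          show ((k + 1 : ℕ) : ℤ) - (k + 1 + d : ℕ) = -d by push_cast; ring, this]
        ring
      · rw [gb_of_lt q (by omega : b < k + 1)]; ring
    rw [sum_congr rfl e, sum_sub_distrib, ← mul_sum]
    have h0 : ∑ k ∈ range (b + 1), cf q u v (((k + 1 : ℕ) : ℤ) - b) * gb q b (k + 1)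
       = ∑ k ∈ range (b + 1), cf q u v ((k : ℤ) - b) * gb q b k - cf q u v (-b) := by
      rw [sum_range_succ, gb_of_lt q (by omega : b < b + 1),
        sum_range_succ' (fun k : ℕ => cf q u v ((k : ℤ) - b) * gb q b k) b]
      simp
    rw [h0]
    have := cf_neg_succ q u v b
    rw [show ((0 : ℕ) : ℤ) - (b + 1 : ℕ) = (-(b + 1 : ℕ)) by simp, this]
    simp only [gb_zero_right]
    ring

/-- Finite Jacobi triple product. -/
lemma jtp (q u v : R) (huv : u * v = q) (a b : ℕ) :
    (∏ i ∈ range a, (1 - u * q ^ i)) * ∏ i ∈ range b, (1 - v * q ^ i) =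
      ∑ k ∈ range (a + b + 1), cf q u v ((k : ℤ) - b) * gb q (a + b) k := by
  induction a with
  | zero => simpa using jtp_zero q u v b
  | succ a ih =>
    have key : ((∏ i ∈ range (a + 1), (1 - u * q ^ i)) * ∏ i ∈ range b, (1 - v * q ^ i)) =
       (1 - u * q ^ a) * ((∏ i ∈ range a, (1 - u * q ^ i)) * ∏ i ∈ range b, (1 - v * q ^ i)) := by
      rw [prod_range_succ]; ring
    rw [key, ih, show a + 1 + b = a + b + 1 by omega, sum_range_succ' _ (a + b + 1)]
    have e : ∀ k ∈ range (a + b + 1), cf q u v (((k + 1 : ℕ) : ℤ) - b) * gb q (a + b + 1) (k + 1)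
       = cf q u v (((k + 1 : ℕ) : ℤ) - b) * gb q (a + b) (k + 1)
         - u * q ^ a * (cf q u v ((k : ℤ) - b) * gb q (a + b) k) := by
      intro k hk
      simp only [mem_range] at hk
      rw [gb_succ]
      rcases Nat.lt_or_ge k b with h | h
      · obtain ⟨d, rfl⟩ : ∃ d, b = k + 1 + d := ⟨b - k - 1, by omega⟩
        have := cf_neg_succ q u v d
        rw [show ((k : ℤ) - (k + 1 + d : ℕ)) = (-(d + 1 : ℕ)) by push_cast; ring,
          show ((k + 1 : ℕ) : ℤ) - (k + 1 + d : ℕ) = -d by push_cast; ring, this,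
          show a + (k + 1 + d) - k = a + d + 1 by omega, pow_succ q (a + d)]
        linear_combination (-(q ^ (a + d) * cf q u v (-d) * gb q (a + (k + 1 + d)) k)) * huv
      · obtain ⟨d, rfl⟩ : ∃ d, k = b + d := ⟨k - b, by omega⟩
        obtain ⟨f, rfl⟩ : ∃ f, a = d + f := ⟨a - d, by omega⟩
        have := cf_succ q u v d
        rw [show (((b + d : ℕ) : ℤ) - b) = d by push_cast; ring,
          show ((b + d + 1 : ℕ) : ℤ) - b = (d + 1 : ℕ) by push_cast; ring, this,
          show d + f + b - (b + d) = f by omega]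
        ring
    rw [sum_congr rfl e, sum_sub_distrib, ← mul_sum]
    have h0 : ∑ k ∈ range (a + b + 1), cf q u v (((k + 1 : ℕ) : ℤ) - b) * gb q (a + b) (k + 1)
       = ∑ k ∈ range (a + b + 1), cf q u v ((k : ℤ) - b) * gb q (a + b) k - cf q u v (-b) := by
      rw [sum_range_succ, gb_of_lt q (by omega : a + b < a + b + 1),
        sum_range_succ' (fun k : ℕ => cf q u v ((k : ℤ) - b) * gb q (a + b) k) (a + b)]
      simp
    rw [h0]
    simp only [gb_zero_right]
    simp
    ring

/-- Zero-extension to the integers. -/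
def rz (r : ℕ → R) (n : ℤ) : R := if 0 ≤ n then r n.toNat else 0

lemma rz_nat (r : ℕ → R) (n : ℕ) : rz r n = r n := by simp [rz]
lemma rz_neg (r : ℕ → R) {n : ℤ} (h : n < 0) : rz r n = 0 := by simp [rz, h]

/-- Bailey-type sum. -/
noncomputable def bs (r : ℕ → R) (C : ℤ → R) (L s : ℕ) : R :=
  ∑ j ∈ Icc (-(L : ℤ)) L, C j * (rz r (s - j) * rz r (s + j))

lemma bs_eq (r : ℕ → R) (C : ℤ → R) {L s : ℕ} (h : s ≤ L) :
    bs r C L s = ∑ k ∈ range (s + s + 1), C ((k : ℤ) - s) * (r (s + s - k) * r k) := by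
  symm
  unfold bs
  refine sum_of_injOn (fun k : ℕ => (k : ℤ) - s) ?_ ?_ ?_ ?_
  · intro a _ b _ hab; simp at hab; exact hab
  · intro k hk; simp at hk ⊢; omega
  · intro j hj hj2
    have : (s : ℤ) - j < 0 ∨ (s : ℤ) + j < 0 := by
      by_contra hcon
      push Not at hcon
      apply hj2
      refine ⟨(s + j).toNat, ?_, ?_⟩
      · simp; omega
      · simp; omega
    rcases this with h | h <;> simp [rz_neg r h]
  · intro k hk
    simp at hk
    rw [show (s : ℤ) - (k - s) = (s + s - k : ℕ) by omega, show (s : ℤ) + (k - s) = k by omega,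
      rz_nat, rz_nat]

lemma bailey_aux {q : R} {r : ℕ → R} (h : IsInv q r) (N a : ℕ) :
    ∑ s ∈ range (N + 1), q ^ (s ^ 2) * r (N - s) * (rz r (s - a) * rz r (s + a))
      = q ^ (a ^ 2) * (rz r (N - a) * rz r (N + a)) := by
  rcases Nat.lt_or_ge N a with hN | hN
  · rw [rz_neg r (by omega : (N : ℤ) - a < 0)]
    simp only [zero_mul, mul_zero]
    refine sum_eq_zero fun s hs => ?_
    rw [rz_neg r (by simp at hs; omega : (s : ℤ) - a < 0)]; simp
  · obtain ⟨A, rfl⟩ := Nat.exists_eq_add_of_le hN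
    rw [add_assoc, sum_range_add, sum_eq_zero, zero_add]
    · rw [show ((a + A : ℕ) : ℤ) - a = A by push_cast; ring,
        show ((a + A : ℕ) : ℤ) + a = (A + 2 * a : ℕ) by push_cast; ring, rz_nat, rz_nat,
        ← vandermonde h, mul_sum]
      refine sum_congr rfl fun t ht => ?_
      rw [show ((a + t : ℕ) : ℤ) - a = t by push_cast; ring,
        show ((a + t : ℕ) : ℤ) + a = (t + 2 * a : ℕ) by push_cast; ring, rz_nat, rz_nat,
        show a + A - (a + t) = A - t by omega]
      ring
    · intro s hs
      rw [rz_neg r (by simp at hs; omega : (s : ℤ) - a < 0)]; simp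

lemma bailey {q : R} {r : ℕ → R} (h : IsInv q r) (C : ℤ → R) (L N : ℕ) :
    ∑ s ∈ range (N + 1), q ^ (s ^ 2) * r (N - s) * bs r C L s
      = bs r (fun j => C j * q ^ (j.natAbs ^ 2)) L N := by
  unfold bs
  simp_rw [mul_sum]
  rw [sum_comm]
  refine sum_congr rfl fun j hj => ?_
  have : ∑ s ∈ range (N + 1), q ^ (s ^ 2) * r (N - s) * (rz r (s - j) * rz r (s + j))
      = q ^ (j.natAbs ^ 2) * (rz r (N - j) * rz r (N + j)) := by
    rcases Int.natAbs_eq j with hj | hj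
    · have := bailey_aux h N j.natAbs
      rw [← hj] at this; exact this
    · have := bailey_aux h N j.natAbs
      rw [show (j.natAbs : ℤ) = - j by omega] at this
      simp only [sub_neg_eq_add, ← sub_eq_add_neg] at this
      rw [mul_comm (rz r (N - j)), ← this]
      refine sum_congr rfl fun s _ => by ring
  rw [mul_assoc, ← this, mul_sum]
  exact sum_congr rfl fun s _ => by ring

lemma bs_cf {q u v : R} (huv : u * v = q) {r : ℕ → R} (h : IsInv q r) {L s : ℕ} (hs : s ≤ L) :
    bs r (cf q u v) L s =
      (∏ i ∈ range s, (1 - u * q ^ i)) * (∏ i ∈ range s, (1 - v * q ^ i)) * r (s + s) := by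
  rw [bs_eq r _ hs, jtp q u v huv, sum_mul]
  refine sum_congr rfl fun k hk => ?_
  have := h.gb_mul (n := s + s) (k := k) (by simp at hk; omega)
  linear_combination (- cf q u v (k - s)) * this

lemma seed {q : R} {r : ℕ → R} (h : IsInv q r) {L s : ℕ} (hs : s ≤ L) :
    bs r (cf q 1 q) L s = if s = 0 then 1 else 0 := by
  rw [bs_cf (by ring) h hs]
  split_ifs with h0
  · subst h0; simp [h.zero]
  · obtain ⟨t, rfl⟩ := Nat.exists_eq_succ_of_ne_zero h0
    rw [Nat.succ_eq_add_one, prod_range_succ']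
    simp

lemma chain1 {q : R} {r : ℕ → R} (h : IsInv q r) {L N : ℕ} (hN : N ≤ L) :
    bs r (fun j => cf q 1 q j * q ^ (j.natAbs ^ 2)) L N = r N := by
  rw [← bailey h, sum_range_succ', sum_eq_zero]
  · rw [seed h (Nat.zero_le _)]; simp
  · intro s hs
    rw [seed h (by simp at hs; omega)]; simp

/-- The theta coefficients for modulus 5. -/
lemma cf_five (q : R) (j : ℤ) :
    cf q 1 q j * q ^ (j.natAbs ^ 2) * q ^ (j.natAbs ^ 2) = cf (q ^ 5) (q ^ 2) (q ^ 3) j := by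
  have hc : ∀ j : ℕ, j + 2 * j.choose 2 = j ^ 2 := by
    intro j
    induction j with
    | zero => rfl
    | succ j ih => rw [Nat.choose_succ_succ' j 1, Nat.choose_one_right]; linarith
  rcases Int.natAbs_eq j with hj | hj
  · rw [hj, cf_nat, cf_nat, Int.natAbs_natCast, ← hc]; ring
  · rw [hj, cf_neg, cf_neg, Int.natAbs_neg, Int.natAbs_natCast, ← hc]; ring

lemma chain2 {q : R} {r : ℕ → R} (h : IsInv q r) (N : ℕ) :
    bs r (cf (q ^ 5) (q ^ 2) (q ^ 3)) N N =
      ∑ s ∈ range (N + 1), q ^ (s ^ 2) * r (N - s) * r s := by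
  have : cf (q ^ 5) (q ^ 2) (q ^ 3) =
      fun j => (fun j => cf q 1 q j * q ^ (j.natAbs ^ 2)) j * q ^ (j.natAbs ^ 2) := by
    funext j; exact (cf_five q j).symm
  rw [this, ← bailey h]
  refine sum_congr rfl fun s hs => ?_
  rw [chain1 h (by simp at hs; omega)]

lemma poch_stable {q : R} {M : ℕ} (hq : q ^ M = 0) {n : ℕ} (hn : M ≤ n) :
    poch q n = poch q M := by
  induction n, hn using Nat.le_induction with
  | base => rfl
  | succ n hn ih =>
    rw [poch, prod_range_succ, ← poch, ih, pow_eq_zero_of_le (by omega) hq]; simp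

lemma IsInv.stable {q : R} {r : ℕ → R} (h : IsInv q r) {M : ℕ} (hq : q ^ M = 0) {n : ℕ}
    (hn : M ≤ n) : r n = r M := by
  have h1 := h n
  have h2 := h M
  rw [poch_stable hq hn] at h1
  linear_combination (- r n) * h2 + r M * h1

lemma cf_vanish {q : R} {M : ℕ} (hq : q ^ M = 0) {j : ℤ} (hj : M ≤ j.natAbs) :
    cf (q ^ 5) (q ^ 2) (q ^ 3) j = 0 := by
  rw [← cf_five, pow_eq_zero_of_le (by nlinarith : M ≤ j.natAbs ^ 2) hq]; simp

lemma bs_stable {q q' : R} {r : ℕ → R} (h : IsInv q' r) {M : ℕ} (hq : q ^ M = 0)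
    (hq' : q' ^ M = 0) {N : ℕ} (hN : 2 * M ≤ N) :
    bs r (cf (q ^ 5) (q ^ 2) (q ^ 3)) N N =
      (∑ j ∈ Icc (-(N : ℤ)) N, cf (q ^ 5) (q ^ 2) (q ^ 3) j) * (r M * r M) := by
  rw [bs, sum_mul]
  refine sum_congr rfl fun j hj => ?_
  rcases Nat.lt_or_ge j.natAbs M with hM | hM
  · rw [show (N : ℤ) - j = ((N - j).toNat : ℕ) by omega,
      show (N : ℤ) + j = ((N + j).toNat : ℕ) by omega, rz_nat, rz_nat,
      h.stable hq' (by omega : M ≤ ((N : ℤ) - j).toNat), h.stable hq' (by omega : M ≤ ((N : ℤ) + j).toNat)]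
  · rw [cf_vanish hq hM]; simp

lemma poch_five (q : R) (N : ℕ) : poch q (5 * N) = poch (q ^ 5) N *
    ((∏ i ∈ range N, (1 - q ^ 2 * (q ^ 5) ^ i)) * ∏ i ∈ range N, (1 - q ^ 3 * (q ^ 5) ^ i)) *
    ∏ i ∈ range N, ((1 - q ^ (5 * i + 1)) * (1 - q ^ (5 * i + 4))) := by
  induction N with
  | zero => simp [poch]
  | succ N ih =>
    rw [show 5 * (N + 1) = 5 * N + 1 + 1 + 1 + 1 + 1 by ring]
    simp only [poch, prod_range_succ] at ih ⊢
    rw [ih]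
    ring

/-- Rogers–Ramanujan modulo `q ^ M`. -/
theorem rr_mod {q : R} {r r5 : ℕ → R} (h : IsInv q r) (h5 : IsInv (q ^ 5) r5) {M : ℕ}
    (hM : 0 < M) (hq : q ^ M = 0) {N : ℕ} (hN : 2 * M ≤ N) :
    (∑ s ∈ range (N + 1), q ^ (s ^ 2) * r s) *
      ∏ i ∈ range N, ((1 - q ^ (5 * i + 1)) * (1 - q ^ (5 * i + 4))) = 1 := by
  have hq5 : (q ^ 5) ^ M = 0 := by rw [← pow_mul]; exact pow_eq_zero_of_le (by omega) hq
  have e1 := chain2 h N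
  rw [bs_stable h hq hq hN] at e1
  have e2 : ∑ s ∈ range (N + 1), q ^ (s ^ 2) * r (N - s) * r s
      = (∑ s ∈ range (N + 1), q ^ (s ^ 2) * r s) * r M := by
    rw [sum_mul]
    refine sum_congr rfl fun s hs => ?_
    rcases Nat.lt_or_ge s M with hs | hs
    · rw [h.stable hq (by omega : M ≤ N - s)]; ring
    · rw [pow_eq_zero_of_le (by nlinarith : M ≤ s ^ 2) hq]; simp
  rw [e2] at e1
  have e3 := bs_cf (q := q ^ 5) (u := q ^ 2) (v := q ^ 3) (by ring) h5 (le_refl N)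
  rw [bs_stable h5 hq hq5 hN, h5.stable hq5 (by omega : M ≤ N + N)] at e3
  have e4 := poch_five q N
  rw [poch_stable hq (by omega : M ≤ 5 * N), poch_stable hq5 (by omega : M ≤ N)] at e4
  have i1 := h M
  have i2 := h5 M
  set Θ := ∑ j ∈ Icc (-(N : ℤ)) N, cf (q ^ 5) (q ^ 2) (q ^ 3) j
  set F := ∑ s ∈ range (N + 1), q ^ (s ^ 2) * r s
  set Q := ∏ i ∈ range N, ((1 - q ^ (5 * i + 1)) * (1 - q ^ (5 * i + 4)))
  set P := (∏ i ∈ range N, (1 - q ^ 2 * (q ^ 5) ^ i)) * ∏ i ∈ range N, (1 - q ^ 3 * (q ^ 5) ^ i)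
  have f1 : F = Θ * r M := by
    linear_combination (-(poch q M)) * e1 + (Θ * r M - F) * i1
  have f2 : Θ = P * poch (q ^ 5) M := by
    linear_combination (poch (q ^ 5) M) ^ 2 * e3
      + (P * poch (q ^ 5) M - Θ * (poch (q^5) M * r5 M + 1)) * i2
  rw [f1, f2]
  linear_combination i1 - r M * e4

end RR

namespace RR
open PowerSeries

/-- Difference-two lists of length `s` and sum `n`. -/
def dl (s n : ℕ) : Set (List ℕ) :=
  {l | (∀ x ∈ l, 0 < x) ∧ l.IsChain (fun a b => b + 2 ≤ a) ∧ l.sum = n ∧ l.length = s}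

lemma sum_map_add (l : List ℕ) (c : ℕ) : (l.map (· + c)).sum = l.sum + c * l.length := by
  induction l with
  | nil => simp
  | cons a l ih => simp [ih]; ring

lemma chain_map_add (l : List ℕ) (c : ℕ) :
    (l.map (· + c)).IsChain (fun a b => b + 2 ≤ a) ↔ l.IsChain (fun a b => b + 2 ≤ a) := by
  rw [List.isChain_map]
  refine Iff.of_eq (congrArg (fun S => List.IsChain S l) ?_)
  funext a b
  exact propext ⟨fun h => by omega, fun h => by omega⟩

lemma exists_map_add (l : List ℕ) (c : ℕ) (h : ∀ x ∈ l, c < x) :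
    ∃ m : List ℕ, (∀ x ∈ m, 0 < x) ∧ m.map (· + c) = l := by
  refine ⟨l.map (· - c), ?_, ?_⟩
  · intro x hx
    obtain ⟨y, hy, rfl⟩ := List.mem_map.1 hx
    have := h y hy; omega
  · rw [List.map_map]
    conv_rhs => rw [← List.map_id l]
    refine List.map_congr_left fun x hx => ?_
    have := h x hx
    simp; omega

lemma chain_append_iff (l : List ℕ) (a : ℕ) :
    (l ++ [a]).IsChain (fun a b => b + 2 ≤ a) ↔
      l.IsChain (fun a b => b + 2 ≤ a) ∧ ∀ x ∈ l, a + 2 ≤ x := by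
  have : IsTrans ℕ (fun a b => b + 2 ≤ a) := ⟨fun a b c h1 h2 => by omega⟩
  rw [List.isChain_iff_pairwise, List.isChain_iff_pairwise, List.pairwise_append]
  simp

lemma dl_zero (n : ℕ) : dl 0 n = if n = 0 then {[]} else ∅ := by
  ext l
  split_ifs with h
  · subst h
    simp only [dl, Set.mem_ofPred_eq, Set.mem_singleton_iff, List.length_eq_zero_iff]
    constructor
    · tauto
    · rintro rfl; simp
  · simp only [dl, Set.mem_ofPred_eq, List.length_eq_zero_iff, Set.mem_empty_iff_false, iff_false]
    rintro ⟨_, _, h3, rfl⟩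
    simp at h3; omega

/-- lists ending in `1` -/
lemma dl_succ (s n : ℕ) : dl (s + 1) n =
    {l | ∃ m, 2 * s + 1 + m = n ∧ l ∈ (fun l => l.map (· + 2) ++ [1]) '' dl s m} ∪
    {l | ∃ m, s + 1 + m = n ∧ l ∈ (fun l => l.map (· + 1)) '' dl (s + 1) m} := by
  ext l
  simp only [dl, Set.mem_ofPred_eq, Set.mem_union, Set.mem_image]
  constructor
  · rintro ⟨hpos, hch, hs, hl⟩
    rcases List.eq_nil_or_concat' l with rfl | ⟨l, a, rfl⟩
    · simp at hl
    rw [chain_append_iff] at hch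
    have ha : 0 < a := hpos a (by simp)
    simp only [List.sum_append, List.sum_cons, List.sum_nil, List.length_append, List.length_cons,
      List.length_nil] at hs hl
    by_cases h1 : a = 1
    · subst h1
      left
      obtain ⟨m, hm, rfl⟩ := exists_map_add l 2 (fun x hx => by have := hch.2 x hx; omega)
      rw [sum_map_add] at hs
      rw [List.length_map] at hl
      refine ⟨m.sum, ?_, m, ⟨hm, ?_, rfl, by omega⟩, rfl⟩
      · have : m.length = s := by omega
        subst this; omega
      · exact (chain_map_add m 2).1 hch.1
    · right
      obtain ⟨m, hm, hml⟩ := exists_map_add (l ++ [a]) 1 (fun x hx => by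
        simp at hx
        rcases hx with hx | rfl
        · have := hch.2 x hx; omega
        · omega)
      have hlen := congrArg List.length hml
      have hsum := congrArg List.sum hml
      have hc : (l ++ [a]).IsChain (fun a b => b + 2 ≤ a) := (chain_append_iff _ _).2 hch
      rw [sum_map_add] at hsum
      simp at hlen hsum
      refine ⟨m.sum, by omega, m, ⟨hm, ?_, rfl, by omega⟩, hml⟩
      rw [← hml] at hc
      exact (chain_map_add m 1).1 hc
  · rintro (⟨k, hk, m, ⟨hm, hc, hs, hl⟩, rfl⟩ | ⟨k, hk, m, ⟨hm, hc, hs, hl⟩, rfl⟩)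
    · refine ⟨?_, ?_, ?_, ?_⟩
      · intro x hx; simp at hx; rcases hx with ⟨y, _, rfl⟩ | rfl <;> omega
      · rw [chain_append_iff, chain_map_add]
        refine ⟨hc, ?_⟩
        intro x hx
        obtain ⟨y, hy, rfl⟩ := List.mem_map.1 hx
        have := hm y hy; omega
      · rw [List.sum_append, sum_map_add, hs, hl]; simp; omega
      · simp [hl]
    · refine ⟨?_, ?_, ?_, ?_⟩
      · intro x hx; simp at hx; rcases hx with ⟨y, _, rfl⟩; omega
      · rwa [chain_map_add]
      · rw [sum_map_add, hs, hl]; omega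
      · simp [hl]

lemma dl_finite (s n : ℕ) : (dl s n).Finite := by
  refine Set.Finite.subset
    ((List.finite_length_eq (Fin (n + 1)) s).image (fun l => l.map Fin.val)) ?_
  rintro l ⟨_, _, h, h'⟩
  have hle : ∀ x ∈ l, x < n + 1 := fun x hx => by
    have := List.le_sum_of_mem hx
    omega
  refine ⟨l.pmap (fun x hx => ⟨x, hx⟩) hle, ?_, ?_⟩
  · simpa using h'
  · simp [List.map_pmap]

lemma ncard_ex (A : ℕ → Set (List ℕ)) (f : List ℕ → List ℕ) (hf : Function.Injective f) (c n : ℕ) :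
    {l | ∃ m, c + m = n ∧ l ∈ f '' A m}.ncard = if c ≤ n then (A (n - c)).ncard else 0 := by
  split_ifs with h
  · rw [← Set.ncard_image_of_injective (A (n - c)) hf]
    congr 1
    ext l
    constructor
    · rintro ⟨m, rfl, hm⟩; simpa using hm
    · intro hl; exact ⟨n - c, by omega, hl⟩
  · rw [show {l | ∃ m, c + m = n ∧ l ∈ f '' A m} = ∅ by
      ext l; simp; intro m hm; omega]
    simp

lemma dl_ncard_succ (s n : ℕ) : (dl (s + 1) n).ncard =
    (if 2 * s + 1 ≤ n then (dl s (n - (2 * s + 1))).ncard else 0) +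
    (if s + 1 ≤ n then (dl (s + 1) (n - (s + 1))).ncard else 0) := by
  have hfin := dl_finite (s + 1) n
  have hinj : ∀ c : ℕ, Function.Injective (fun l : List ℕ => l.map (· + c)) := fun c =>
    List.map_injective_iff.2 (fun a b h => by simpa using h)
  rw [dl_succ] at hfin
  rw [dl_succ, Set.ncard_union_eq ?_ (hfin.subset Set.subset_union_left)
    (hfin.subset Set.subset_union_right), ncard_ex (dl s), ncard_ex (dl (s + 1))]
  · exact hinj 1
  · intro a b h
    exact hinj 2 (List.append_cancel_right h)
  · rw [Set.disjoint_left]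
    rintro l ⟨k, hk, m, hm, rfl⟩ ⟨k', hk', m', hm', h⟩
    have : 1 ∈ m'.map (· + 1) := by simp only at h; rw [h]; simp
    obtain ⟨y, hy, hy'⟩ := List.mem_map.1 this
    have := hm'.1 y hy
    omega

/-- Generating function of difference-two lists of length `s`. -/
noncomputable def gf (s : ℕ) : ℤ⟦X⟧ := PowerSeries.mk fun n => ((dl s n).ncard : ℤ)

lemma gf_zero : gf 0 = 1 := by
  ext n
  rw [gf, coeff_mk, dl_zero, coeff_one]
  split_ifs <;> simp

lemma gf_succ (s : ℕ) : (1 - X ^ (s + 1)) * gf (s + 1) = X ^ (2 * s + 1) * gf s := by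
  have : gf (s + 1) = X ^ (2 * s + 1) * gf s + X ^ (s + 1) * gf (s + 1) := by
    ext n
    rw [map_add, coeff_X_pow_mul', coeff_X_pow_mul']
    simp only [gf, coeff_mk]
    rw [dl_ncard_succ]
    push_cast
    rfl
  linear_combination this

lemma card_left (n N : ℕ) (hN : n ≤ N) :
    (Nat.card {l : List ℕ // (∀ x ∈ l, 0 < x) ∧ l.IsChain (fun a b => b + 2 ≤ a) ∧ l.sum = n} : ℤ)
      = coeff n (∑ s ∈ range (N + 1), gf s) := by
  rw [map_sum]
  simp only [gf, coeff_mk]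
  rw [← Nat.cast_sum]
  congr 1
  have : ∀ s, (dl s n).ncard = (dl_finite s n).toFinset.card := fun s =>
    Set.ncard_eq_toFinset_card _ _
  simp_rw [this]
  rw [← card_biUnion]
  · rw [← Set.ncard_coe_finset]
    change Set.ncard {l : List ℕ | _} = _
    congr 1
    ext l
    simp only [dl, Set.mem_ofPred_eq, coe_biUnion, coe_range, Set.Finite.coe_toFinset, Set.mem_iUnion,
      Set.mem_Iio, exists_prop]
    constructor
    · rintro ⟨h1, h2, h3⟩
      refine ⟨l.length, ?_, h1, h2, h3, rfl⟩
      have : l.length ≤ l.sum := List.length_le_sum_of_one_le l (fun x hx => h1 x hx)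
      omega
    · rintro ⟨s, _, h1, h2, h3, _⟩; exact ⟨h1, h2, h3⟩
  · intro s _ t _ hst
    rw [Function.onFun, Finset.disjoint_left]
    intro l h1 h2
    simp [dl] at h1 h2
    omega

open scoped PowerSeries.WithPiTopology in
lemma restricted_mod (M : ℕ) : ∃ K, M ≤ K ∧
    X ^ M ∣ (PowerSeries.mk fun n => (#(Nat.Partition.restricted n (fun x => x % 5 = 1 ∨ x % 5 = 4)) : ℤ))
      * (∏ i ∈ range K, ((1 - X ^ (5 * i + 1)) * (1 - X ^ (5 * i + 4)))) - 1 := by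
  classical
  have hp := Nat.Partition.hasProd_powerSeriesMk_card_restricted ℤ (fun x => x % 5 = 1 ∨ x % 5 = 4)
  set G : ℤ⟦X⟧ := PowerSeries.mk fun n =>
    (#(Nat.Partition.restricted n (fun x => x % 5 = 1 ∨ x % 5 = 4)) : ℤ)
  rw [HasProd] at hp
  replace hp := (WithPiTopology.tendsto_iff_coeff_tendsto _ _ _ _).1 hp
  have hev : ∀ᶠ s : Finset ℕ in Filter.atTop, ∀ d ∈ range M,
      coeff d (∏ i ∈ s, (if (i + 1) % 5 = 1 ∨ (i + 1) % 5 = 4 then ∑' j : ℕ, (X : ℤ⟦X⟧) ^ ((i + 1) * j) else 1))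
        = coeff d G := by
    rw [Filter.eventually_all_finset]
    intro d _
    have := hp d
    rw [nhds_discrete, Filter.tendsto_pure] at this
    exact this
  obtain ⟨s0, hs0⟩ := Filter.eventually_atTop.1 hev
  set K := M + s0.sup id + 1
  have hK := hs0 (range (5 * K)) (by
    intro x hx
    have : x ≤ s0.sup id := le_sup (f := id) hx
    simp; omega)
  refine ⟨K, by omega, ?_⟩
  set H := ∏ i ∈ range (5 * K), (if (i + 1) % 5 = 1 ∨ (i + 1) % 5 = 4 then ∑' j : ℕ, (X : ℤ⟦X⟧) ^ ((i + 1) * j) else 1)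
    with hH
  have hHQ : ∀ K, (∏ i ∈ range (5 * K), (if (i + 1) % 5 = 1 ∨ (i + 1) % 5 = 4 then ∑' j : ℕ, (X : ℤ⟦X⟧) ^ ((i + 1) * j) else 1)) * (∏ i ∈ range K, ((1 - X ^ (5 * i + 1)) * (1 - X ^ (5 * i + 4)))) = 1 := by
    intro K
    induction K with
    | zero => simp
    | succ K ih =>
      have t : ∀ n : ℕ, (∑' j : ℕ, (X : ℤ⟦X⟧) ^ ((n + 1) * j)) * (1 - X ^ (n + 1)) = 1 := by
        intro n
        simp_rw [pow_mul]
        exact WithPiTopology.tsum_pow_mul_one_sub_of_constantCoeff_eq_zero (by simp)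
      rw [show 5 * (K + 1) = 5 * K + 1 + 1 + 1 + 1 + 1 by ring]
      simp only [prod_range_succ]
      rw [if_pos (by omega), if_neg (by omega), if_neg (by omega), if_pos (by omega),
        if_neg (by omega)]
      have t1 := t (5 * K)
      have t2 := t (5 * K + 1 + 1 + 1)
      rw [show 5 * K + 4 = 5 * K + 1 + 1 + 1 + 1 by ring]
      simp only [mul_one]
      generalize (∏ i ∈ range (5 * K), _ : ℤ⟦X⟧) = a at *
      generalize (∏ i ∈ range K, _ : ℤ⟦X⟧) = b at *
      generalize (∑' j : ℕ, (X : ℤ⟦X⟧) ^ ((5 * K + 1) * j)) = c at *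
      generalize (∑' j : ℕ, (X : ℤ⟦X⟧) ^ ((5 * K + 1 + 1 + 1 + 1) * j)) = d at *
      calc _ = (a * b) * (c * (1 - X ^ (5 * K + 1))) * (d * (1 - X ^ (5 * K + 1 + 1 + 1 + 1))) := by ring
        _ = 1 := by rw [ih, t1, t2]; ring
  have h1 := hHQ K
  have h2 : X ^ M ∣ G - H := by
    rw [X_pow_dvd_iff]
    intro m hm
    rw [map_sub, hK m (by simpa using hm), sub_self]
  rw [← hH] at h1
  generalize (∏ i ∈ range K, _ : ℤ⟦X⟧) = b at *
  rw [← h1, ← sub_mul]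
  exact Dvd.dvd.mul_right h2 _

lemma isUnit_poch {S : Type*} [CommRing S] {q : S} (hq : IsNilpotent q) (n : ℕ) :
    IsUnit (poch q n) := by
  unfold poch
  induction n with
  | zero => simp
  | succ n ih =>
    rw [prod_range_succ]
    exact ih.mul (hq.pow_succ n).isUnit_one_sub

lemma exists_isInv {S : Type*} [CommRing S] {q : S} (hq : IsNilpotent q) : ∃ r, IsInv q r := by
  choose r hr using fun n => (isUnit_poch hq n).exists_right_inv
  exact ⟨r, hr⟩

end RR

theorem macmahon_schur_rogers_ramanujan (n : ℕ) :
    Nat.card {l : List ℕ // (∀ x ∈ l, 0 < x) ∧ l.Chain' (fun a b => b + 2 ≤ a) ∧ l.sum = n} =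
      Nat.card {p : n.Partition // ∀ x ∈ p.parts, x % 5 = 1 ∨ x % 5 = 4} := by
  obtain ⟨K, hK, hG⟩ := RR.restricted_mod (2 * (n + 1))
  set G : PowerSeries ℤ := PowerSeries.mk fun n =>
    (#(Nat.Partition.restricted n (fun x => x % 5 = 1 ∨ x % 5 = 4)) : ℤ) with hGdef
  let I : Ideal (PowerSeries ℤ) := Ideal.span {PowerSeries.X ^ (n + 1)}
  let φ := Ideal.Quotient.mk I
  let q := φ PowerSeries.X
  have hφ : ∀ a b, φ a = φ b ↔ PowerSeries.X ^ (n + 1) ∣ a - b := by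
    intro a b
    rw [Ideal.Quotient.eq, Ideal.mem_span_singleton]
  have hq : q ^ (n + 1) = 0 := by
    rw [← map_pow, ← map_zero φ, hφ]; simp
  obtain ⟨r, hr⟩ := RR.exists_isInv ⟨n + 1, hq⟩
  obtain ⟨r5, hr5⟩ := RR.exists_isInv (q := q ^ 5)
    ⟨n + 1, by rw [← pow_mul]; exact pow_eq_zero_of_le (by omega) hq⟩
  have main := RR.rr_mod hr hr5 (Nat.succ_pos n) hq hK
  have hgf : ∀ s, φ (RR.gf s) = q ^ (s ^ 2) * r s := by
    intro s
    induction s with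
    | zero => rw [RR.gf_zero, hr.zero]; simp
    | succ s ih =>
      have h1 := congrArg φ (RR.gf_succ s)
      simp only [map_mul, map_sub, map_pow, map_one] at h1
      change (1 - q ^ (s + 1)) * _ = q ^ (2 * s + 1) * _ at h1
      rw [ih, hr.succ s] at h1
      have hu : IsUnit (1 - q ^ (s + 1)) :=
        (IsNilpotent.pow_succ s ⟨n + 1, hq⟩ : IsNilpotent (q ^ (s + 1))).isUnit_one_sub
      refine hu.mul_left_cancel ?_
      rw [h1]; ring
  have hF : φ (∑ s ∈ range (K + 1), RR.gf s) = φ G := by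
    have h2 : φ G * ∏ i ∈ range K, ((1 - q ^ (5 * i + 1)) * (1 - q ^ (5 * i + 4))) = 1 := by
      have := (hφ _ _).2 ((pow_dvd_pow _ (by omega)).trans hG)
      simpa only [map_mul, map_prod, map_sub, map_pow, map_one] using this
    have h3 : φ (∑ s ∈ range (K + 1), RR.gf s) *
        ∏ i ∈ range K, ((1 - q ^ (5 * i + 1)) * (1 - q ^ (5 * i + 4))) = 1 := by
      rw [map_sum, sum_congr rfl fun s _ => hgf s]
      exact main
    rw [← mul_one (φ G), ← h3, mul_left_comm, h2, mul_one]
  have hc := (PowerSeries.X_pow_dvd_iff.1 ((hφ _ _).1 hF)) n (by omega)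
  rw [map_sub, sub_eq_zero, ← RR.card_left n K (by omega), hGdef, PowerSeries.coeff_mk] at hc
  have hc' := Int.natCast_inj.1 hc
  refine hc'.trans ?_
  rw [Nat.card_eq_fintype_card, Fintype.card_subtype]
  rfl
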